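/- In X = 𝔽² with the ℓ¹ norm, let x = (1,0), y = (0,1), x* = (1,0), y* = (0,1) (acting via the dual pairing). Then x is norm parallel to y, but the rank-one operators x*(·)x and y*(·)y are not numerical radius parallel. -/

import Mathlib

open Filter Topology

variable {𝕜 : Type*} [RCLike 𝕜] {X : Type*} [NormedAddCommGroup X] [NormedSpace 𝕜 X]

/-- The numerical radius of a bounded linear operator on a normed space:
`v(T) = sup {|x*(Tx)| : x ∈ S_X, x* ∈ J(x)}`. -/
noncomputable def nrad (T : X →L[𝕜] X) : ℝ :=
  sSup {r : ℝ | ∃ (x : X) (f : X →L[𝕜] 𝕜), ‖x‖ = 1 ∧ ‖f‖ = 1 ∧ f x = 1 ∧ r = ‖f (T x)‖}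

/-- Numerical radius parallelism: `T ∥_v S`. -/
def NRadParallel (T S : X →L[𝕜] X) : Prop :=
  ∃ lam : 𝕜, ‖lam‖ = 1 ∧ nrad (T + lam • S) = nrad T + nrad S

/-- Numerical radius Birkhoff orthogonality: `T ⊥_{vB} S`. -/
def NRadBirkhoff (T S : X →L[𝕜] X) : Prop :=
  ∀ α : 𝕜, nrad T ≤ nrad (T + α • S)

/-- The `i`-th coordinate functional on `𝔽²` with the `ℓ¹` norm (an element of the
dual, identified with `𝔽²` with the max norm acting by the dual pairing). -/
noncomputable def coordFun (𝔽 : Type*) [RCLike 𝔽] (i : Fin 2) :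
    PiLp 1 (fun _ : Fin 2 => 𝔽) →L[𝔽] 𝔽 :=
  (ContinuousLinearMap.proj i).comp
    (PiLp.continuousLinearEquiv 1 𝔽 (fun _ : Fin 2 => 𝔽)).toContinuousLinearMap

/-- The `i`-th standard basis vector of `𝔽²` with the `ℓ¹` norm. -/
noncomputable def basisVec (𝔽 : Type*) [RCLike 𝔽] (i : Fin 2) :
    PiLp 1 (fun _ : Fin 2 => 𝔽) :=
  (WithLp.equiv 1 (Fin 2 → 𝔽)).symm (Pi.single i 1)

theorem nrad_le_aux (T : X →L[𝕜] X) (hT : ∀ x, ‖T x‖ ≤ ‖x‖) : nrad T ≤ 1 := by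
  apply Real.sSup_le _ zero_le_one
  rintro r ⟨x, f, hx, hf, -, rfl⟩
  calc ‖f (T x)‖ ≤ ‖f‖ * ‖T x‖ := f.le_opNorm _
    _ ≤ 1 := by rw [hf, one_mul, ← hx]; exact hT x

theorem le_nrad_aux (T : X →L[𝕜] X) (hT : ∀ x, ‖T x‖ ≤ ‖x‖) (x : X) (f : X →L[𝕜] 𝕜)
    (hx : ‖x‖ = 1) (hf : ‖f‖ = 1) (hfx : f x = 1) (h : f (T x) = 1) : 1 ≤ nrad T := by
  apply le_csSup
  · refine ⟨1, ?_⟩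
    rintro r ⟨x, f, hx, hf, -, rfl⟩
    calc ‖f (T x)‖ ≤ ‖f‖ * ‖T x‖ := f.le_opNorm _
      _ ≤ 1 := by rw [hf, one_mul, ← hx]; exact hT x
  · exact ⟨x, f, hx, hf, hfx, by simp [h]⟩

theorem norm_aux (𝔽 : Type*) [RCLike 𝔽] (x : PiLp 1 (fun _ : Fin 2 => 𝔽)) :
    ‖x‖ = ‖x 0‖ + ‖x 1‖ := by
  rw [PiLp.norm_eq_of_nat 1 (by simp)]
  simp

theorem coord_aux (𝔽 : Type*) [RCLike 𝔽] (i : Fin 2) (x : PiLp 1 (fun _ : Fin 2 => 𝔽)) :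
    coordFun 𝔽 i x = x i := rfl

theorem basis_aux (𝔽 : Type*) [RCLike 𝔽] (i j : Fin 2) :
    basisVec 𝔽 i j = if j = i then 1 else 0 := by
  change (Pi.single i (1 : 𝔽) : Fin 2 → 𝔽) j = _
  rw [Pi.single_apply]

theorem basis_norm_aux (𝔽 : Type*) [RCLike 𝔽] (i : Fin 2) : ‖basisVec 𝔽 i‖ = 1 := by
  rw [norm_aux]
  fin_cases i <;> simp [basis_aux]

theorem coord_norm_aux (𝔽 : Type*) [RCLike 𝔽] (i : Fin 2) : ‖coordFun 𝔽 i‖ = 1 := by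
  apply le_antisymm
  · apply ContinuousLinearMap.opNorm_le_bound _ zero_le_one
    intro x
    rw [coord_aux, norm_aux]
    fin_cases i <;> simp
  · have := (coordFun 𝔽 i).le_opNorm (basisVec 𝔽 i)
    rw [basis_norm_aux, coord_aux, basis_aux] at this
    simpa using this

theorem one_le_aux (𝔽 : Type*) [RCLike 𝔽] (i : Fin 2) :
    1 ≤ nrad ((coordFun 𝔽 i).smulRight (basisVec 𝔽 i)) := by
  apply le_nrad_aux _ _ (basisVec 𝔽 i) (coordFun 𝔽 i) (basis_norm_aux 𝔽 i) (coord_norm_aux 𝔽 i)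
  · simp [coord_aux, basis_aux]
  · simp [coord_aux, basis_aux]
  · intro x
    rw [ContinuousLinearMap.smulRight_apply, norm_smul, basis_norm_aux, mul_one]
    simpa [coord_norm_aux] using (coordFun 𝔽 i).le_opNorm x

theorem stmt14 (𝔽 : Type*) [RCLike 𝔽] :
    (∃ lam : 𝔽, ‖lam‖ = 1 ∧
      ‖basisVec 𝔽 0 + lam • basisVec 𝔽 1‖ = ‖basisVec 𝔽 0‖ + ‖basisVec 𝔽 1‖) ∧
    ¬ NRadParallel ((coordFun 𝔽 0).smulRight (basisVec 𝔽 0))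
        ((coordFun 𝔽 1).smulRight (basisVec 𝔽 1)) := by
  constructor
  · refine ⟨1, by simp, ?_⟩
    rw [basis_norm_aux, basis_norm_aux, norm_aux]
    simp [basis_aux]
  · rintro ⟨lam, hl, h⟩
    have h0 := one_le_aux 𝔽 0
    have h1 := one_le_aux 𝔽 1
    have h2 := nrad_le_aux ((coordFun 𝔽 0).smulRight (basisVec 𝔽 0) +
      lam • (coordFun 𝔽 1).smulRight (basisVec 𝔽 1)) (by
        intro x
        rw [norm_aux, norm_aux]
        simp [basis_aux, coord_aux, hl])
    linarith
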